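/- arXiv:2011.10908 — 6 statements merged into one kernel-verified Lean document; each statement's English description precedes it below -/
import Mathlib

section
/- Let n ∈ ℕ, p ∈ [0,1], q = 1−p, and θ ∈ [0,1]. Let S ~ Binomial(n,p), and let X be an independent exponential random variable with rate λ > 0 whose mean E[X] = 1/λ satisfies E[X] ≥ √(p·q·n) and E[X] ≥ 1. Let B be the event {S + X > θ·n}, and assume Pr[B] < 1/4. Then there is a universal constant C > 0 (independent of n, p, θ, λ) such that the χ²-divergence of the conditional law of S given the complement of B from the law of S satisfies d_{χ²}((S | ¬B), S) ≤ C · (Pr[B] · √(p·q·n) / E[X])². -/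
/-- `Pr[S = k]` for `S ~ Binomial(n, p)`. -/
noncomputable def binomPMF (n : ℕ) (p : ℝ) (k : ℕ) : ℝ :=
  (n.choose k : ℝ) * p ^ k * (1 - p) ^ (n - k)

/-- `Pr[X > t]` for `X` an exponential random variable with rate `lam > 0`. -/
noncomputable def expTail (lam t : ℝ) : ℝ :=
  if t ≤ 0 then 1 else Real.exp (-(lam * t))

/-- `Pr[S + X > θ·n]` for `S ~ Binomial(n, p)` and `X ~ Exponential(lam)` independent. -/
noncomputable def prAbove (n : ℕ) (p θ lam : ℝ) : ℝ :=
  ∑ k ∈ Finset.range (n + 1), binomPMF n p k * expTail lam (θ * n - k)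

/-- The conditional law of `S` given the complement of `{S + X > θ·n}`. -/
noncomputable def condPMF (n : ℕ) (p θ lam : ℝ) (k : ℕ) : ℝ :=
  binomPMF n p k * (1 - expTail lam (θ * n - k)) / (1 - prAbove n p θ lam)

/-- The expectation of `f S` for `S ~ Binomial(n, p)`. -/
noncomputable def binomExp (n : ℕ) (p : ℝ) (f : ℕ → ℝ) : ℝ :=
  ∑ k ∈ Finset.range (n + 1), binomPMF n p k * f k

theorem binomPMF_nonneg {p : ℝ} (hp0 : 0 ≤ p) (hp1 : p ≤ 1) (n k : ℕ) : 0 ≤ binomPMF n p k := by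
  have : 0 ≤ 1 - p := by linarith
  unfold binomPMF
  positivity

theorem binomPMF_succ_succ (n k : ℕ) (p : ℝ) :
    binomPMF (n + 1) p (k + 1) = (1 - p) * binomPMF n p (k + 1) + p * binomPMF n p k := by
  unfold binomPMF
  rw [Nat.choose_succ_succ, Nat.add_sub_add_right]
  rcases Nat.lt_or_ge k n with h | h
  · have : n - k = n - (k + 1) + 1 := by omega
    rw [this]
    push_cast
    ring
  · rw [Nat.choose_eq_zero_of_lt (show n < k + 1 by omega)]
    push_cast
    ring

theorem binomPMF_succ_zero (n : ℕ) (p : ℝ) :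
    binomPMF (n + 1) p 0 = (1 - p) * binomPMF n p 0 := by
  simp only [binomPMF, Nat.choose_zero_right, Nat.sub_zero]
  ring

theorem binomPMF_self_succ (n : ℕ) (p : ℝ) : binomPMF n p (n + 1) = 0 := by
  simp [binomPMF]

theorem binomExp_zero (p : ℝ) (f : ℕ → ℝ) : binomExp 0 p f = f 0 := by
  simp [binomExp, binomPMF]

theorem binomExp_succ (n : ℕ) (p : ℝ) (f : ℕ → ℝ) :
    binomExp (n + 1) p f = (1 - p) * binomExp n p f + p * binomExp n p (fun k => f (k + 1)) := by
  have h : binomExp n p f =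
      ∑ k ∈ Finset.range (n + 1), binomPMF n p (k + 1) * f (k + 1) + binomPMF n p 0 * f 0 := by
    rw [← Finset.sum_range_succ' (fun k => binomPMF n p k * f k), Finset.sum_range_succ,
      binomPMF_self_succ, binomExp]
    ring
  rw [h]
  unfold binomExp
  rw [Finset.sum_range_succ', binomPMF_succ_zero, mul_add, Finset.mul_sum, Finset.mul_sum,
    add_right_comm, ← Finset.sum_add_distrib, mul_assoc]
  congr 1
  refine Finset.sum_congr rfl fun k _ => ?_
  rw [binomPMF_succ_succ]
  ring

theorem binomExp_mono {p : ℝ} (hp0 : 0 ≤ p) (hp1 : p ≤ 1) (n : ℕ) {f g : ℕ → ℝ}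
    (h : ∀ k, f k ≤ g k) : binomExp n p f ≤ binomExp n p g :=
  Finset.sum_le_sum fun k _ => mul_le_mul_of_nonneg_left (h k) (binomPMF_nonneg hp0 hp1 n k)

theorem binomExp_add (n : ℕ) (p : ℝ) (f g : ℕ → ℝ) :
    binomExp n p (fun k => f k + g k) = binomExp n p f + binomExp n p g := by
  simp only [binomExp, mul_add, Finset.sum_add_distrib]

theorem binomExp_const_mul (n : ℕ) (p c : ℝ) (f : ℕ → ℝ) :
    binomExp n p (fun k => c * f k) = c * binomExp n p f := by
  simp only [binomExp, Finset.mul_sum]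
  exact Finset.sum_congr rfl fun k _ => by ring

theorem binomExp_const (n : ℕ) (p c : ℝ) : binomExp n p (fun _ => c) = c := by
  induction n with
  | zero => exact binomExp_zero p _
  | succ n ih => rw [binomExp_succ, ih]; ring

theorem binomExp_sq_sub (n : ℕ) (p a : ℝ) :
    binomExp n p (fun k => ((k : ℝ) - a) ^ 2) = n * (p * (1 - p)) + (n * p - a) ^ 2 := by
  induction n generalizing a with
  | zero => simp [binomExp_zero]
  | succ n ih =>
    have h : (fun k : ℕ => (((k + 1 : ℕ) : ℝ) - a) ^ 2) = fun k : ℕ => ((k : ℝ) - (a - 1)) ^ 2 := by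
      funext k
      push_cast
      ring
    rw [binomExp_succ, h, ih, ih]
    push_cast
    ring

theorem binomExp_exp (n : ℕ) (p s : ℝ) :
    binomExp n p (fun k => Real.exp (s * k)) = (1 - p + p * Real.exp s) ^ n := by
  induction n with
  | zero => simp [binomExp_zero]
  | succ n ih =>
    have h : (fun k : ℕ => Real.exp (s * ((k + 1 : ℕ) : ℝ))) =
        fun k : ℕ => Real.exp s * Real.exp (s * k) := by
      funext k
      rw [← Real.exp_add]
      push_cast
      ring_nf
    rw [binomExp_succ, h, binomExp_const_mul, ih]
    ring

theorem sq_binomExp_le {p : ℝ} (hp0 : 0 ≤ p) (hp1 : p ≤ 1) (n : ℕ) (f : ℕ → ℝ) :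
    binomExp n p f ^ 2 ≤ binomExp n p (fun k => f k ^ 2) := by
  have h := binomExp_mono hp0 hp1 n (f := fun k => 2 * binomExp n p f * f k)
    (g := fun k => f k ^ 2 + binomExp n p f ^ 2)
    (fun k => by nlinarith [sq_nonneg (f k - binomExp n p f)])
  rw [binomExp_const_mul, binomExp_add, binomExp_const] at h
  nlinarith

/-- A Poincaré inequality for the binomial law and monotone functions whose increments are
controlled by their values. -/
theorem binomExp_variance_le {p L : ℝ} (hp0 : 0 ≤ p) (hp1 : p ≤ 1) (n : ℕ) (f : ℕ → ℝ)
    (hf0 : ∀ k, 0 ≤ f k) (hmono : ∀ k, f k ≤ f (k + 1))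
    (hL : ∀ k, f (k + 1) - f k ≤ L * f k) :
    binomExp n p (fun k => f k ^ 2) - binomExp n p f ^ 2 ≤
      n * (p * (1 - p)) * L ^ 2 * binomExp n p (fun k => f k ^ 2) := by
  induction n generalizing f with
  | zero => simp [binomExp_zero]
  | succ n ih =>
    have hq : 0 ≤ 1 - p := by linarith
    have ih0 := ih f hf0 hmono hL
    have ih1 := ih (fun k => f (k + 1)) (fun k => hf0 _) (fun k => hmono _) (fun k => hL _)
    have hsq := sq_binomExp_le hp0 hp1 n f
    have hinc : binomExp n p f ≤ binomExp n p (fun k => f (k + 1)) :=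
      binomExp_mono hp0 hp1 n hmono
    have hinc2 : binomExp n p (fun k => f (k + 1)) ≤ (1 + L) * binomExp n p f := by
      rw [← binomExp_const_mul]
      exact binomExp_mono hp0 hp1 n fun k => by linarith [hL k]
    have hsqinc : binomExp n p (fun k => f k ^ 2) ≤ binomExp n p (fun k => f (k + 1) ^ 2) :=
      binomExp_mono hp0 hp1 n fun k => pow_le_pow_left₀ (hf0 k) (hmono k) 2
    rw [binomExp_succ, binomExp_succ n p f]
    set a := binomExp n p f
    set b := binomExp n p (fun k => f (k + 1))
    set A := binomExp n p (fun k => f k ^ 2)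
    set B := binomExp n p (fun k => f (k + 1) ^ 2)
    have hd : (b - a) ^ 2 ≤ L ^ 2 * A := by
      calc (b - a) ^ 2 ≤ (L * a) ^ 2 := pow_le_pow_left₀ (by linarith) (by linarith) 2
        _ = L ^ 2 * a ^ 2 := by ring
        _ ≤ L ^ 2 * A := by gcongr
    have hA : A ≤ (1 - p) * A + p * B := by nlinarith
    have hpq : 0 ≤ p * (1 - p) := mul_nonneg hp0 hq
    have h1 := mul_le_mul_of_nonneg_left ih0 hq
    have h2 := mul_le_mul_of_nonneg_left ih1 hp0
    have h3 := mul_le_mul_of_nonneg_left hd hpq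
    have h4 := mul_le_mul_of_nonneg_left hA (mul_nonneg hpq (sq_nonneg L))
    push_cast
    calc (1 - p) * A + p * B - ((1 - p) * a + p * b) ^ 2
        = (1 - p) * (A - a ^ 2) + p * (B - b ^ 2) + p * (1 - p) * (b - a) ^ 2 := by ring
      _ ≤ _ := by linarith

theorem exp_le_one_add_add_sq {x : ℝ} (hx : |x| ≤ 2) :
    Real.exp x ≤ 1 + x + 3 / 2 * x ^ 2 := by
  have hy : |x / 2| ≤ 1 := by rw [abs_div]; norm_num; linarith
  have h := (abs_le.mp (Real.abs_exp_sub_one_sub_id_le hy)).2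
  have h2 := abs_le.mp hx
  have he : Real.exp x = Real.exp (x / 2) ^ 2 := by
    rw [← Real.exp_nat_mul]
    push_cast
    ring_nf
  rw [he]
  calc Real.exp (x / 2) ^ 2 ≤ (1 + x / 2 + (x / 2) ^ 2) ^ 2 :=
        pow_le_pow_left₀ (Real.exp_pos _).le (by linarith) 2
    _ ≤ 1 + x + 3 / 2 * x ^ 2 := by
        nlinarith [mul_nonneg (sq_nonneg x) (mul_nonneg (show 0 ≤ 2 - x by linarith)
          (show 0 ≤ 2 + x by linarith)), mul_nonneg (sq_nonneg x) (show 0 ≤ 2 - x by linarith)]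

/-- The moment generating function of the centred binomial law near the origin. -/
theorem binomExp_exp_centered_le {p s : ℝ} (hp0 : 0 ≤ p) (hp1 : p ≤ 1) (hs : |s| ≤ 2) (n : ℕ) :
    binomExp n p (fun k => Real.exp (s * ((k : ℝ) - n * p))) ≤
      Real.exp (3 / 2 * s ^ 2 * (p * (1 - p) * n)) := by
  have hq : 0 ≤ 1 - p := by linarith
  have h : (fun k : ℕ => Real.exp (s * ((k : ℝ) - n * p))) =
      fun k : ℕ => Real.exp (-(s * p)) ^ n * Real.exp (s * k) := by
    funext k
    rw [← Real.exp_nat_mul, ← Real.exp_add]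
    ring_nf
  rw [h, binomExp_const_mul, binomExp_exp, ← mul_pow]
  have e0 := exp_le_one_add_add_sq (x := -(s * p)) (by
    rw [abs_neg, abs_mul, abs_of_nonneg hp0]; nlinarith [abs_nonneg s])
  have e1 := exp_le_one_add_add_sq (x := s * (1 - p)) (by
    rw [abs_mul, abs_of_nonneg hq]; nlinarith [abs_nonneg s])
  have he : Real.exp (s * (1 - p)) = Real.exp (-(s * p)) * Real.exp s := by
    rw [← Real.exp_add]
    ring_nf
  have hb : Real.exp (-(s * p)) * (1 - p + p * Real.exp s) ≤
      Real.exp (3 / 2 * s ^ 2 * (p * (1 - p))) := by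
    calc Real.exp (-(s * p)) * (1 - p + p * Real.exp s)
        = (1 - p) * Real.exp (-(s * p)) + p * Real.exp (s * (1 - p)) := by rw [he]; ring
      _ ≤ (1 - p) * (1 + -(s * p) + 3 / 2 * (-(s * p)) ^ 2) +
          p * (1 + s * (1 - p) + 3 / 2 * (s * (1 - p)) ^ 2) := by gcongr
      _ = 3 / 2 * s ^ 2 * (p * (1 - p)) + 1 := by ring
      _ ≤ _ := Real.add_one_le_exp _
  calc _ ≤ Real.exp (3 / 2 * s ^ 2 * (p * (1 - p))) ^ n :=
        pow_le_pow_left₀ (by positivity) hb n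
    _ = _ := by
        rw [← Real.exp_nat_mul]
        ring_nf

theorem expTail_sub_eq_exp_min {lam : ℝ} (hlam : 0 < lam) (t x : ℝ) :
    expTail lam (t - x) = Real.exp (min 0 (lam * (x - t))) := by
  unfold expTail
  split_ifs with h
  · rw [min_eq_left (mul_nonneg hlam.le (by linarith)), Real.exp_zero]
  · rw [min_eq_right (mul_nonpos_of_nonneg_of_nonpos hlam.le (by linarith))]
    ring_nf

theorem expTail_nonneg (lam t : ℝ) : 0 ≤ expTail lam t := by
  unfold expTail
  split_ifs
  · exact zero_le_one
  · exact (Real.exp_pos _).le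

/-- The exponential tail is log-Lipschitz and monotone. -/
theorem expTail_sub_le {lam : ℝ} (hlam : 0 < lam) (t x y : ℝ) :
    expTail lam (t - x) ≤ Real.exp (max 0 (lam * (x - y))) * expTail lam (t - y) := by
  rw [expTail_sub_eq_exp_min hlam, expTail_sub_eq_exp_min hlam, ← Real.exp_add, Real.exp_le_exp]
  have h0 := le_max_left 0 (lam * (x - y))
  have h1 := le_max_right 0 (lam * (x - y))
  have h2 := min_le_left 0 (lam * (x - t))
  have h3 := min_le_right 0 (lam * (x - t))
  rcases min_choice 0 (lam * (y - t)) with h | h <;> rw [h] <;> nlinarith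

theorem expTail_le_exp_mul_binomExp {n : ℕ} {p lam : ℝ} (hp0 : 0 ≤ p) (hp1 : p ≤ 1)
    (hlam : 0 < lam) (hvar : lam ^ 2 * (p * (1 - p) * n) ≤ 1) (t : ℝ) :
    expTail lam (t - n * p) ≤ Real.exp 1 * binomExp n p (fun k => expTail lam (t - k)) := by
  have hpt : ∀ k : ℕ, (3 / 2 + -(lam ^ 2 / 2) * ((k : ℝ) - n * p) ^ 2) * expTail lam (t - n * p) ≤
      Real.exp 1 * expTail lam (t - k) := by
    intro k
    set d := (k : ℝ) - n * p with hd
    have h := expTail_sub_le hlam t (n * p) k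
    have hmax : max 0 (lam * (n * p - k)) ≤ lam * |d| := by
      refine max_le (by positivity) ?_
      have := neg_le_abs d
      nlinarith
    have hle : expTail lam (t - n * p) ≤ Real.exp (lam * |d|) * expTail lam (t - k) :=
      h.trans (mul_le_mul_of_nonneg_right (Real.exp_le_exp.mpr hmax) (expTail_nonneg _ _))
    have htan : 3 / 2 + -(lam ^ 2 / 2) * d ^ 2 ≤ Real.exp (1 - lam * |d|) := by
      have h1 := Real.add_one_le_exp (1 - lam * |d|)
      have h2 : (lam * |d|) ^ 2 = lam ^ 2 * d ^ 2 := by rw [mul_pow, sq_abs]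
      nlinarith [sq_nonneg (lam * |d| - 1)]
    calc _ ≤ Real.exp (1 - lam * |d|) * expTail lam (t - n * p) :=
          mul_le_mul_of_nonneg_right htan (expTail_nonneg _ _)
      _ ≤ Real.exp (1 - lam * |d|) * (Real.exp (lam * |d|) * expTail lam (t - k)) :=
          mul_le_mul_of_nonneg_left hle (Real.exp_pos _).le
      _ = _ := by rw [← mul_assoc, ← Real.exp_add]; ring_nf
  have h := binomExp_mono hp0 hp1 n hpt
  have hcomm : (fun k : ℕ => (3 / 2 + -(lam ^ 2 / 2) * ((k : ℝ) - n * p) ^ 2) *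
      expTail lam (t - n * p)) = fun k : ℕ => expTail lam (t - n * p) *
      (3 / 2 + -(lam ^ 2 / 2) * ((k : ℝ) - n * p) ^ 2) := by
    funext k
    ring
  rw [hcomm, binomExp_const_mul, binomExp_add, binomExp_const, binomExp_const_mul,
    binomExp_sq_sub, binomExp_const_mul] at h
  refine le_trans ?_ h
  nlinarith [expTail_nonneg lam (t - n * p)]

theorem binomExp_expTail_sq_le {n : ℕ} {p lam : ℝ} (hp0 : 0 ≤ p) (hp1 : p ≤ 1)
    (hlam : 0 < lam) (hlam1 : lam ≤ 1) (hvar : lam ^ 2 * (p * (1 - p) * n) ≤ 1) (t : ℝ) :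
    binomExp n p (fun k => expTail lam (t - k) ^ 2) ≤
      (1 + Real.exp 6) * expTail lam (t - n * p) ^ 2 := by
  have hpt : ∀ k : ℕ, expTail lam (t - k) ^ 2 ≤
      expTail lam (t - n * p) ^ 2 * (1 + Real.exp (2 * lam * ((k : ℝ) - n * p))) := by
    intro k
    have h := pow_le_pow_left₀ (expTail_nonneg _ _) (expTail_sub_le hlam t k (n * p)) 2
    refine h.trans ?_
    rw [mul_pow, mul_comm]
    refine mul_le_mul_of_nonneg_left ?_ (sq_nonneg _)
    rw [← Real.exp_nat_mul]
    rcases max_choice 0 (lam * ((k : ℝ) - n * p)) with h | h <;> rw [h]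
    · simp [(Real.exp_pos _).le]
    · rw [show ((2 : ℕ) : ℝ) * (lam * ((k : ℝ) - n * p)) = 2 * lam * ((k : ℝ) - n * p) by
        push_cast; ring]
      linarith
  have h := binomExp_mono hp0 hp1 n hpt
  rw [binomExp_const_mul, binomExp_add, binomExp_const] at h
  have hmgf := binomExp_exp_centered_le hp0 hp1 (s := 2 * lam)
    (by rw [abs_of_nonneg (by positivity)]; linarith) n
  have h6 : Real.exp (3 / 2 * (2 * lam) ^ 2 * (p * (1 - p) * n)) ≤ Real.exp 6 :=
    Real.exp_le_exp.mpr (by nlinarith)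
  refine h.trans ?_
  rw [mul_comm]
  exact mul_le_mul_of_nonneg_right (by linarith) (sq_nonneg _)

theorem chiSq_condPMF_eq (n : ℕ) (p θ lam : ℝ) (hP : prAbove n p θ lam < 1) :
    ∑ k ∈ Finset.range (n + 1),
        binomPMF n p k * (condPMF n p θ lam k / binomPMF n p k - 1) ^ 2 =
      (binomExp n p (fun k => expTail lam (θ * n - k) ^ 2) - prAbove n p θ lam ^ 2) /
        (1 - prAbove n p θ lam) ^ 2 := by
  have hE : binomExp n p (fun k => expTail lam (θ * n - k)) = prAbove n p θ lam := rfl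
  have hne : 1 - prAbove n p θ lam ≠ 0 := by linarith
  set P := prAbove n p θ lam with hPdef
  have hterm : ∀ k : ℕ, binomPMF n p k * (condPMF n p θ lam k / binomPMF n p k - 1) ^ 2 =
      binomPMF n p k * (((1 - P) ^ 2)⁻¹ * ((expTail lam (θ * n - k) ^ 2 +
        (-2 * P) * expTail lam (θ * n - k)) + P ^ 2)) := by
    intro k
    by_cases hb : binomPMF n p k = 0
    · simp [hb]
    · rw [condPMF, ← hPdef]
      field_simp
      ring
  rw [Finset.sum_congr rfl fun k _ => hterm k]
  change binomExp n p _ = _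
  rw [binomExp_const_mul, binomExp_add, binomExp_add, binomExp_const_mul, binomExp_const, hE]
  field_simp
  ring

/-- **χ²-stable threshold reporting.**  If `S ~ Binomial(n,p)`, `X ~ Exponential(lam)` is
independent with mean `1/lam ≥ √(p(1-p)n)` and `1/lam ≥ 1`, and the event
`B = {S + X > θn}` has `Pr[B] < 1/4`, then
`d_{χ²}((S ∣ ¬B), S) ≤ C · (Pr[B] · √(p(1-p)n) / E[X])²` for a universal constant `C`. -/
theorem chiSq_stable_threshold_reporting :
    ∃ C : ℝ, 0 < C ∧
      ∀ (n : ℕ) (p θ lam : ℝ),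
        0 ≤ p → p ≤ 1 → 0 ≤ θ → θ ≤ 1 →
        0 < lam → lam ≤ 1 →
        lam * Real.sqrt (p * (1 - p) * n) ≤ 1 →
        prAbove n p θ lam < 1 / 4 →
        ∑ k ∈ Finset.range (n + 1),
            binomPMF n p k * (condPMF n p θ lam k / binomPMF n p k - 1) ^ 2
          ≤ C * (prAbove n p θ lam * Real.sqrt (p * (1 - p) * n) * lam) ^ 2 := by
  refine ⟨16 / 9 * (4 * ((1 + Real.exp 6) * Real.exp 1 ^ 2)), by positivity, ?_⟩
  intro n p θ lam hp0 hp1 _ _ hlam hlam1 hsd hP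
  have hq : 0 ≤ 1 - p := by linarith
  have hv0 : 0 ≤ p * (1 - p) * n := by positivity
  have hvar : lam ^ 2 * (p * (1 - p) * n) ≤ 1 := by
    have h := pow_le_pow_left₀ (by positivity) hsd 2
    rwa [mul_pow, Real.sq_sqrt hv0, one_pow] at h
  rw [chiSq_condPMF_eq n p θ lam (by linarith), mul_pow, mul_pow, Real.sq_sqrt hv0]
  have hlow := expTail_le_exp_mul_binomExp hp0 hp1 hlam hvar (θ * n)
  have hsq := binomExp_expTail_sq_le hp0 hp1 hlam hlam1 hvar (θ * n)
  have hexp : Real.exp lam ≤ 1 + 2 * lam := by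
    have h := (abs_le.mp (Real.abs_exp_sub_one_sub_id_le
      (show |lam| ≤ 1 by rwa [abs_of_pos hlam]))).2
    nlinarith
  have hpoin := binomExp_variance_le (L := 2 * lam) hp0 hp1 n (fun k => expTail lam (θ * n - k))
    (fun k => expTail_nonneg _ _)
    (fun k => by
      have h := expTail_sub_le hlam (θ * n) k ((k + 1 : ℕ) : ℝ)
      rwa [max_eq_left (by push_cast; nlinarith), Real.exp_zero, one_mul] at h)
    (fun k => by
      have h := expTail_sub_le hlam (θ * n) ((k + 1 : ℕ) : ℝ) k
      rw [max_eq_right (by push_cast; nlinarith),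
        show lam * (((k + 1 : ℕ) : ℝ) - k) = lam by push_cast; ring] at h
      nlinarith [expTail_nonneg lam (θ * n - k)])
  change _ - prAbove n p θ lam ^ 2 ≤ _ at hpoin
  change _ ≤ _ * prAbove n p θ lam at hlow
  set P := prAbove n p θ lam
  set V := binomExp n p (fun k => expTail lam (θ * n - k) ^ 2)
  have hV : V ≤ (1 + Real.exp 6) * (Real.exp 1 * P) ^ 2 :=
    hsq.trans (mul_le_mul_of_nonneg_left (pow_le_pow_left₀ (expTail_nonneg _ _) hlow 2)
      (by positivity))
  have hnum : V - P ^ 2 ≤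
      4 * ((1 + Real.exp 6) * Real.exp 1 ^ 2) * (P ^ 2 * (p * (1 - p) * n) * lam ^ 2) := by
    calc V - P ^ 2 ≤ n * (p * (1 - p)) * (2 * lam) ^ 2 * V := hpoin
      _ ≤ n * (p * (1 - p)) * (2 * lam) ^ 2 * ((1 + Real.exp 6) * (Real.exp 1 * P) ^ 2) := by
          gcongr
      _ = _ := by ring
  have hden : 9 / 16 ≤ (1 - P) ^ 2 := by nlinarith
  rw [div_le_iff₀ (by positivity)]
  have hR : 0 ≤ 4 * ((1 + Real.exp 6) * Real.exp 1 ^ 2) *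
      (P ^ 2 * (p * (1 - p) * n) * lam ^ 2) := by positivity
  nlinarith [mul_le_mul_of_nonneg_left hden hR]
end

section
/- Let n ∈ ℕ, p ∈ [0,1], q = 1−p, and θ ∈ [0,1]. Let S ~ Binomial(n,p), and let X be an independent exponential random variable with rate λ > 0 whose mean E[X] = 1/λ satisfies E[X] ≥ √(p·q·n) and E[X] ≥ 1. Let B be the event {S + X > θ·n}, and assume Pr[B] < 1/4. Then there is a universal constant C > 0 such that the total variation distance between the conditional law of S given the complement of B and the law of S satisfies d_{TV}((S | ¬B), S) ≤ C · Pr[B] · √(p·q·n) / E[X] ≤ C · Pr[B] · √n / E[X]. -/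
open Finset in
theorem sum_binomPMF (n : ℕ) (p : ℝ) : ∑ k ∈ range (n + 1), binomPMF n p k = 1 := by
  have h := add_pow p (1 - p) n
  rw [add_sub_cancel, one_pow] at h
  rw [h]
  exact sum_congr rfl fun k _ => by rw [binomPMF]; ring

open Finset in
theorem sum_binomPMF_mul_sq (n : ℕ) (p : ℝ) :
    ∑ k ∈ range (n + 1), binomPMF n p k * ((k : ℝ) - n * p) ^ 2 = p * (1 - p) * n := by
  have h := congrArg (Polynomial.eval p) (bernsteinPolynomial.variance ℝ n)
  simp only [Polynomial.eval_finsetSum, bernsteinPolynomial, Polynomial.eval_mul,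
    Polynomial.eval_pow, Polynomial.eval_sub, Polynomial.eval_X, Polynomial.eval_one,
    Polynomial.eval_natCast, nsmul_eq_mul] at h
  calc _ = _ := sum_congr rfl fun k _ => by rw [binomPMF]; ring
    _ = _ := h
    _ = _ := by ring

open Finset in
theorem sum_binomPMF_mul_exp (n : ℕ) (p s : ℝ) :
    ∑ k ∈ range (n + 1), binomPMF n p k * Real.exp (s * (k - n * p)) =
      (p * Real.exp (s * (1 - p)) + (1 - p) * Real.exp (-(s * p))) ^ n := by
  rw [add_pow]
  refine sum_congr rfl fun k hk => ?_
  have hkn : k ≤ n := Nat.lt_succ_iff.mp (mem_range.mp hk)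
  have he : Real.exp (s * (k - n * p)) =
      Real.exp (s * (1 - p)) ^ k * Real.exp (-(s * p)) ^ (n - k) := by
    rw [← Real.exp_nat_mul, ← Real.exp_nat_mul, ← Real.exp_add, Nat.cast_sub hkn]
    congr 1
    ring
  rw [he, binomPMF, mul_pow, mul_pow]
  ring

theorem exp_two_mul_le {x : ℝ} (hx : |x| ≤ 1) : Real.exp (2 * x) ≤ 1 + 2 * x + 6 * x ^ 2 := by
  have h := (abs_le.mp (Real.abs_exp_sub_one_sub_id_le hx)).2
  have h0 := Real.exp_pos x
  obtain ⟨h1, h2⟩ := abs_le.mp hx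
  have he : Real.exp (2 * x) = Real.exp x ^ 2 := by rw [← Real.exp_nat_mul]; norm_num
  have hs : Real.exp x ^ 2 ≤ (1 + x + x ^ 2) ^ 2 := by
    gcongr
    linarith
  rw [he]
  nlinarith [mul_nonneg (sq_nonneg x) (by linarith : 0 ≤ 1 - x),
    mul_nonneg (sq_nonneg x) (by nlinarith : 0 ≤ 1 - x ^ 2)]

/-- The moment generating function of a centred binomial variable is subgaussian near `0`. -/
theorem sum_binomPMF_mul_exp_two_le {p : ℝ} (hp0 : 0 ≤ p) (hp1 : p ≤ 1) (n : ℕ) {s : ℝ}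
    (hs : |s| ≤ 1) :
    ∑ k ∈ Finset.range (n + 1), binomPMF n p k * Real.exp (2 * s * (k - n * p)) ≤
      Real.exp (6 * (s ^ 2 * (p * (1 - p) * n))) := by
  have hq : 0 ≤ 1 - p := by linarith
  have h1 : |s * (1 - p)| ≤ 1 := by
    rw [abs_mul, abs_of_nonneg hq]
    nlinarith [abs_nonneg s]
  have h2 : |(-(s * p))| ≤ 1 := by
    rw [abs_neg, abs_mul, abs_of_nonneg hp0]
    nlinarith [abs_nonneg s]
  have e1 := mul_le_mul_of_nonneg_left (exp_two_mul_le h1) hp0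
  have e2 := mul_le_mul_of_nonneg_left (exp_two_mul_le h2) hq
  have e3 := Real.add_one_le_exp (6 * (s ^ 2 * (p * (1 - p))))
  rw [sum_binomPMF_mul_exp,
    show 6 * (s ^ 2 * (p * (1 - p) * n)) = n * (6 * (s ^ 2 * (p * (1 - p)))) by ring,
    Real.exp_nat_mul, show 2 * s * (1 - p) = 2 * (s * (1 - p)) by ring,
    show -(2 * s * p) = 2 * -(s * p) by ring]
  refine pow_le_pow_left₀ (by positivity) ?_ n
  calc _ ≤ _ := add_le_add e1 e2
    _ = 6 * (s ^ 2 * (p * (1 - p))) + 1 := by ring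
    _ ≤ _ := e3

theorem sum_binomPMF_mul_exp_abs_le {p lam : ℝ} (hp0 : 0 ≤ p) (hp1 : p ≤ 1) (n : ℕ)
    (hl0 : 0 ≤ lam) (hl1 : lam ≤ 1) (hl : lam * √(p * (1 - p) * n) ≤ 1) :
    ∑ k ∈ Finset.range (n + 1), binomPMF n p k * Real.exp (lam * |k - n * p|) ^ 2 ≤
      2 * Real.exp 6 := by
  have hv : 0 ≤ p * (1 - p) * n := by
    have : 0 ≤ 1 - p := by linarith
    positivity
  have hsq : lam ^ 2 * (p * (1 - p) * n) ≤ 1 := by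
    rw [← Real.sq_sqrt hv, ← mul_pow]
    exact pow_le_one₀ (by positivity) hl
  have hb : Real.exp (6 * (lam ^ 2 * (p * (1 - p) * n))) ≤ Real.exp 6 := by
    gcongr
    linarith
  have h1 := sum_binomPMF_mul_exp_two_le hp0 hp1 n (s := lam) (by rwa [abs_of_nonneg hl0])
  have h2 := sum_binomPMF_mul_exp_two_le hp0 hp1 n (s := -lam) (by rwa [abs_neg, abs_of_nonneg hl0])
  rw [neg_sq] at h2
  have h3 : ∑ k ∈ Finset.range (n + 1), binomPMF n p k * Real.exp (lam * |k - n * p|) ^ 2 ≤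
      ∑ k ∈ Finset.range (n + 1), binomPMF n p k * Real.exp (2 * lam * (k - n * p)) +
      ∑ k ∈ Finset.range (n + 1), binomPMF n p k * Real.exp (2 * -lam * (k - n * p)) := by
    rw [← Finset.sum_add_distrib]
    refine Finset.sum_le_sum fun k _ => ?_
    rw [← mul_add, ← Real.exp_nat_mul]
    refine mul_le_mul_of_nonneg_left ?_ (binomPMF_nonneg hp0 hp1 n k)
    rcases abs_cases ((k : ℝ) - n * p) with ⟨h, -⟩ | ⟨h, -⟩ <;> rw [h]
    · refine le_add_of_le_of_nonneg (le_of_eq ?_) (Real.exp_nonneg _)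
      congr 1
      push_cast
      ring
    · refine le_add_of_nonneg_of_le (Real.exp_nonneg _) (le_of_eq ?_)
      congr 1
      push_cast
      ring
  linarith

/-- Cauchy–Schwarz for a finite weighted sum. -/
theorem sum_mul_mul_le_sqrt_mul_sqrt {ι : Type*} (s : Finset ι) {w : ι → ℝ} (hw : ∀ i, 0 ≤ w i)
    (f g : ι → ℝ) :
    ∑ i ∈ s, w i * (f i * g i) ≤ √(∑ i ∈ s, w i * f i ^ 2) * √(∑ i ∈ s, w i * g i ^ 2) := by
  have h := Real.sum_mul_le_sqrt_mul_sqrt s (fun i => √(w i) * f i) fun i => √(w i) * g i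
  simp only [mul_pow, Real.sq_sqrt (hw _)] at h
  refine le_trans (le_of_eq (Finset.sum_congr rfl fun i _ => ?_)) h
  linear_combination (-(f i * g i)) * Real.mul_self_sqrt (hw i)

theorem sum_binomPMF_mul_abs_le {p : ℝ} (hp0 : 0 ≤ p) (hp1 : p ≤ 1) (n : ℕ) :
    ∑ k ∈ Finset.range (n + 1), binomPMF n p k * |(k : ℝ) - n * p| ≤ √(p * (1 - p) * n) := by
  have h := sum_mul_mul_le_sqrt_mul_sqrt (Finset.range (n + 1)) (binomPMF_nonneg hp0 hp1 n)
    (fun k => |(k : ℝ) - n * p|) fun _ => 1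
  simpa [sum_binomPMF_mul_sq, sum_binomPMF] using h

theorem expTail_pos (lam t : ℝ) : 0 < expTail lam t := by
  unfold expTail
  split_ifs <;> positivity

theorem expTail_le_mul {lam : ℝ} (hl : 0 ≤ lam) (t u : ℝ) :
    expTail lam t ≤ Real.exp (lam * |t - u|) * expTail lam u := by
  have h0 : 0 ≤ lam * |t - u| := by positivity
  have h1 : lam * (u - t) ≤ lam * |t - u| :=
    mul_le_mul_of_nonneg_left (by rw [abs_sub_comm]; exact le_abs_self _) hl
  unfold expTail
  split_ifs with ht hu hu
  · simpa using h0
  · rw [← Real.exp_add, Real.one_le_exp_iff]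
    nlinarith
  · rw [mul_one, Real.exp_le_exp]
    nlinarith
  · rw [← Real.exp_add, Real.exp_le_exp]
    nlinarith

theorem abs_expTail_sub_le {lam : ℝ} (hl : 0 ≤ lam) (t u : ℝ) :
    |expTail lam t - expTail lam u| ≤
      expTail lam u * (lam * (|t - u| * Real.exp (lam * |t - u|))) := by
  have h1 := expTail_le_mul hl t u
  have h2 := expTail_le_mul hl u t
  have hu := expTail_pos lam u
  have ht := expTail_pos lam t
  rw [abs_sub_comm u t] at h2
  have hx : 0 ≤ lam * |t - u| := by positivity
  have he : lam * (|t - u| * Real.exp (lam * |t - u|)) =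
      lam * |t - u| * Real.exp (lam * |t - u|) := by ring
  rw [he]
  generalize lam * |t - u| = x at *
  have hE : 1 ≤ Real.exp x := Real.one_le_exp hx
  have hx1 : Real.exp x - 1 ≤ x * Real.exp x := by
    have h := mul_le_mul_of_nonneg_right (Real.add_one_le_exp (-x)) (Real.exp_nonneg x)
    rw [← Real.exp_add, neg_add_cancel, Real.exp_zero] at h
    linarith
  have h3 := mul_le_mul_of_nonneg_left hx1 hu.le
  rw [abs_le]
  constructor
  · rcases le_total (expTail lam u) (expTail lam t) with h | h
    · nlinarith
    · nlinarith
  · nlinarith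

theorem expTail_mul_le {lam : ℝ} (hl : 0 ≤ lam) (t u : ℝ) :
    expTail lam u * (Real.exp (-1) * (2 - lam * |t - u|)) ≤ expTail lam t := by
  have h2 := expTail_le_mul hl u t
  rw [abs_sub_comm u t] at h2
  have h3 : Real.exp (-1) * (2 - lam * |t - u|) ≤ Real.exp (-(lam * |t - u|)) := by
    have := mul_le_mul_of_nonneg_left (Real.add_one_le_exp (1 - lam * |t - u|))
      (Real.exp_nonneg (-1))
    rw [← Real.exp_add] at this
    rw [show -1 + (1 - lam * |t - u|) = -(lam * |t - u|) by ring] at this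
    linarith
  calc _ ≤ expTail lam u * Real.exp (-(lam * |t - u|)) :=
        mul_le_mul_of_nonneg_left h3 (expTail_pos lam u).le
    _ ≤ Real.exp (lam * |t - u|) * expTail lam t * Real.exp (-(lam * |t - u|)) :=
        mul_le_mul_of_nonneg_right h2 (Real.exp_nonneg _)
    _ = expTail lam t := by
        rw [mul_right_comm, ← Real.exp_add, add_neg_cancel, Real.exp_zero, one_mul]

theorem prAbove_nonneg {p : ℝ} (hp0 : 0 ≤ p) (hp1 : p ≤ 1) (n : ℕ) (θ lam : ℝ) :
    0 ≤ prAbove n p θ lam :=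
  Finset.sum_nonneg fun k _ => mul_nonneg (binomPMF_nonneg hp0 hp1 n k) (expTail_pos _ _).le

theorem abs_threshold_sub (n k : ℕ) (p θ : ℝ) :
    |θ * n - k - (θ * n - n * p)| = |(k : ℝ) - n * p| := by
  rw [← abs_neg]
  congr 1
  ring

/-- The reporting probability is comparable to its value with `S` replaced by its mean. -/
theorem expTail_mean_le {p lam : ℝ} (hp0 : 0 ≤ p) (hp1 : p ≤ 1) (n : ℕ) (θ : ℝ)
    (hl0 : 0 ≤ lam) (hl : lam * √(p * (1 - p) * n) ≤ 1) :
    expTail lam (θ * n - n * p) ≤ Real.exp 1 * prAbove n p θ lam := by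
  set a := expTail lam (θ * n - n * p) with ha
  have ha0 : 0 < a := expTail_pos _ _
  have h1 : ∑ k ∈ Finset.range (n + 1),
      binomPMF n p k * (a * (Real.exp (-1) * (2 - lam * |(k : ℝ) - n * p|))) ≤
        prAbove n p θ lam := by
    refine Finset.sum_le_sum fun k _ => mul_le_mul_of_nonneg_left ?_ (binomPMF_nonneg hp0 hp1 n k)
    rw [← abs_threshold_sub n k p θ]
    exact expTail_mul_le hl0 _ _
  have h2 : ∑ k ∈ Finset.range (n + 1),
      binomPMF n p k * (a * (Real.exp (-1) * (2 - lam * |(k : ℝ) - n * p|))) =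
        a * Real.exp (-1) * (2 - lam *
          ∑ k ∈ Finset.range (n + 1), binomPMF n p k * |(k : ℝ) - n * p|) := by
    calc _ = ∑ k ∈ Finset.range (n + 1), a * Real.exp (-1) *
          (2 * binomPMF n p k - lam * (binomPMF n p k * |(k : ℝ) - n * p|)) :=
        Finset.sum_congr rfl fun k _ => by ring
      _ = _ := by
        rw [← Finset.mul_sum, Finset.sum_sub_distrib, ← Finset.mul_sum, ← Finset.mul_sum,
          sum_binomPMF, mul_one]
  have h3 := mul_le_mul_of_nonneg_left (sum_binomPMF_mul_abs_le hp0 hp1 n) hl0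
  have h4 : a * Real.exp (-1) ≤ prAbove n p θ lam := by
    rw [h2] at h1
    refine le_trans ?_ h1
    exact le_mul_of_one_le_right (by positivity) (by linarith)
  calc a = Real.exp 1 * (a * Real.exp (-1)) := by
        rw [mul_left_comm, ← Real.exp_add, add_neg_cancel, Real.exp_zero, mul_one]
    _ ≤ _ := mul_le_mul_of_nonneg_left h4 (Real.exp_nonneg _)

theorem sum_binomPMF_mul_abs_expTail_sub_mean_le {p lam : ℝ} (hp0 : 0 ≤ p) (hp1 : p ≤ 1) (n : ℕ)
    (θ : ℝ) (hl0 : 0 ≤ lam) (hl1 : lam ≤ 1) (hl : lam * √(p * (1 - p) * n) ≤ 1) :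
    ∑ k ∈ Finset.range (n + 1),
      binomPMF n p k * |expTail lam (θ * n - k) - expTail lam (θ * n - n * p)| ≤
        2 * Real.exp 4 * (prAbove n p θ lam * √(p * (1 - p) * n) * lam) := by
  set a := expTail lam (θ * n - n * p) with ha
  have ha0 : 0 < a := expTail_pos _ _
  have hμ := prAbove_nonneg hp0 hp1 n θ lam
  have hcs := sum_mul_mul_le_sqrt_mul_sqrt (Finset.range (n + 1)) (binomPMF_nonneg hp0 hp1 n)
    (fun k => |(k : ℝ) - n * p|) fun k => Real.exp (lam * |(k : ℝ) - n * p|)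
  simp only [sq_abs, sum_binomPMF_mul_sq] at hcs
  have hE : √(∑ k ∈ Finset.range (n + 1), binomPMF n p k * Real.exp (lam * |k - n * p|) ^ 2) ≤
      2 * Real.exp 3 := by
    refine Real.sqrt_le_iff.mpr ⟨by positivity,
      (sum_binomPMF_mul_exp_abs_le hp0 hp1 n hl0 hl1 hl).trans ?_⟩
    rw [mul_pow, ← Real.exp_nat_mul]
    norm_num
    linarith [Real.exp_pos 6]
  calc _ ≤ ∑ k ∈ Finset.range (n + 1), a * lam *
          (binomPMF n p k * (|(k : ℝ) - n * p| * Real.exp (lam * |(k : ℝ) - n * p|))) := by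
        refine Finset.sum_le_sum fun k _ => ?_
        have h := mul_le_mul_of_nonneg_left
          (abs_expTail_sub_le hl0 (θ * n - k) (θ * n - n * p)) (binomPMF_nonneg hp0 hp1 n k)
        rw [abs_threshold_sub] at h
        refine h.trans (le_of_eq ?_)
        rw [ha]
        ring
    _ ≤ (Real.exp 1 * prAbove n p θ lam) * lam * (√(p * (1 - p) * n) * (2 * Real.exp 3)) := by
        rw [← Finset.mul_sum]
        have := expTail_mean_le hp0 hp1 n θ hl0 hl
        have := hcs.trans (mul_le_mul_of_nonneg_left hE (Real.sqrt_nonneg _))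
        gcongr
        exact Finset.sum_nonneg fun k _ => mul_nonneg (binomPMF_nonneg hp0 hp1 n k) (by positivity)
    _ = _ := by
        rw [show (4 : ℝ) = 1 + 3 by norm_num, Real.exp_add]
        ring

/-- The mean absolute deviation about the mean is at most twice that about any point. -/
theorem sum_mul_abs_sub_mean_le {ι : Type*} (s : Finset ι) {w : ι → ℝ} (hw : ∀ i, 0 ≤ w i)
    (hw1 : ∑ i ∈ s, w i = 1) (f : ι → ℝ) (a : ℝ) :
    ∑ i ∈ s, w i * |f i - ∑ j ∈ s, w j * f j| ≤ 2 * ∑ i ∈ s, w i * |f i - a| := by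
  set m := ∑ j ∈ s, w j * f j with hm
  have h1 : |a - m| ≤ ∑ i ∈ s, w i * |f i - a| := by
    have : m - a = ∑ i ∈ s, w i * (f i - a) := by
      simp only [mul_sub, Finset.sum_sub_distrib, ← Finset.sum_mul, hw1, one_mul, hm]
    rw [abs_sub_comm, this]
    refine (Finset.abs_sum_le_sum_abs _ _).trans (le_of_eq (Finset.sum_congr rfl fun i _ => ?_))
    rw [abs_mul, abs_of_nonneg (hw i)]
  have h2 : ∑ i ∈ s, w i * |f i - m| ≤ ∑ i ∈ s, (w i * |f i - a| + w i * |a - m|) :=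
    Finset.sum_le_sum fun i _ => by
      rw [← mul_add]
      exact mul_le_mul_of_nonneg_left (abs_sub_le _ _ _) (hw i)
  rw [Finset.sum_add_distrib, ← Finset.sum_mul, hw1, one_mul] at h2
  linarith

theorem abs_condPMF_sub {p θ lam : ℝ} (hp0 : 0 ≤ p) (hp1 : p ≤ 1) (n k : ℕ)
    (h : prAbove n p θ lam < 1) :
    |condPMF n p θ lam k - binomPMF n p k| =
      binomPMF n p k * |expTail lam (θ * n - k) - prAbove n p θ lam| / (1 - prAbove n p θ lam) := by
  have h' : 0 < 1 - prAbove n p θ lam := by linarith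
  have : condPMF n p θ lam k - binomPMF n p k =
      -(binomPMF n p k * (expTail lam (θ * n - k) - prAbove n p θ lam) /
        (1 - prAbove n p θ lam)) := by
    rw [condPMF]
    field_simp
    ring
  rw [this, abs_neg, abs_div, abs_mul, abs_of_nonneg (binomPMF_nonneg hp0 hp1 n k), abs_of_pos h']

/-- **Total-variation stable threshold reporting.**  Under the hypotheses of the
χ²-stability theorem, `d_TV((S ∣ ¬B), S) ≤ C·Pr[B]·√(p(1-p)n)/E[X] ≤ C·Pr[B]·√n/E[X]`. -/
theorem tv_stable_threshold_reporting :
    ∃ C : ℝ, 0 < C ∧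
      ∀ (n : ℕ) (p θ lam : ℝ),
        0 ≤ p → p ≤ 1 → 0 ≤ θ → θ ≤ 1 →
        0 < lam → lam ≤ 1 →
        lam * Real.sqrt (p * (1 - p) * n) ≤ 1 →
        prAbove n p θ lam < 1 / 4 →
        (1 / 2) * ∑ k ∈ Finset.range (n + 1),
            |condPMF n p θ lam k - binomPMF n p k|
          ≤ C * (prAbove n p θ lam * Real.sqrt (p * (1 - p) * n) * lam)
        ∧ C * (prAbove n p θ lam * Real.sqrt (p * (1 - p) * n) * lam)
          ≤ C * (prAbove n p θ lam * Real.sqrt n * lam) := by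
  refine ⟨4 * Real.exp 4, by positivity, fun n p θ lam hp0 hp1 _ _ hl0 hl1 hl hB => ⟨?_, ?_⟩⟩
  · have hμ := prAbove_nonneg hp0 hp1 n θ lam
    have h1 := sum_mul_abs_sub_mean_le (Finset.range (n + 1)) (binomPMF_nonneg hp0 hp1 n)
      (sum_binomPMF n p) (fun k => expTail lam (θ * n - k)) (expTail lam (θ * n - n * p))
    have h2 := sum_binomPMF_mul_abs_expTail_sub_mean_le hp0 hp1 n θ hl0.le hl1 hl
    rw [← prAbove] at h1
    simp only [abs_condPMF_sub hp0 hp1 n _ (hB.trans (by norm_num : (1 / 4 : ℝ) < 1))]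
    rw [← Finset.sum_div, ← mul_div_assoc, div_le_iff₀ (by linarith)]
    have hR : 0 ≤ Real.exp 4 * (prAbove n p θ lam * √(p * (1 - p) * n) * lam) := by positivity
    nlinarith
  · have hμ := prAbove_nonneg hp0 hp1 n θ lam
    have hv : p * (1 - p) * n ≤ n :=
      mul_le_of_le_one_left (Nat.cast_nonneg n) (by nlinarith)
    gcongr
end

section
/- Fix p ∈ [0,1] and set q = 1−p and C = (e−1)². Then for every λ ∈ [0,1], q + p·e^{2λ} ≤ (1 + C·p·q·λ²) · (q + p·e^{λ})². -/
/-- On `[0,1]` the exponential lies below its chord. -/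
theorem exp_sub_one_le_mul_of_mem_unit {x : ℝ} (h0 : 0 ≤ x) (h1 : x ≤ 1) :
    Real.exp x - 1 ≤ (Real.exp 1 - 1) * x := by
  have h := convexOn_exp.2 (Set.mem_univ 0) (Set.mem_univ 1) (sub_nonneg.2 h1) h0
    (sub_add_cancel 1 x)
  simp only [smul_eq_mul, mul_zero, mul_one, zero_add, Real.exp_zero] at h
  linarith

/-- For `p ∈ [0,1]`, `q = 1 − p`, `C = (e−1)²`, and every `λ ∈ [0,1]`:
`q + p·e^{2λ} ≤ (1 + C·p·q·λ²)·(q + p·e^{λ})²`. -/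
theorem exp_numeric_inequality (p : ℝ) (hp0 : 0 ≤ p) (hp1 : p ≤ 1)
    (lam : ℝ) (hl0 : 0 ≤ lam) (hl1 : lam ≤ 1) :
    (1 - p) + p * Real.exp (2 * lam)
      ≤ (1 + (Real.exp 1 - 1) ^ 2 * p * (1 - p) * lam ^ 2)
          * ((1 - p) + p * Real.exp lam) ^ 2 := by
  have hexp : Real.exp (2 * lam) = Real.exp lam ^ 2 := by
    rw [two_mul, Real.exp_add, sq]
  have hx : 0 ≤ Real.exp lam - 1 := sub_nonneg.2 (Real.one_le_exp hl0)
  have hchord := exp_sub_one_le_mul_of_mem_unit hl0 hl1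
  have hmean : 1 ≤ (1 - p) + p * Real.exp lam := by
    linarith [mul_nonneg hp0 hx]
  have hle : Real.exp lam - 1
      ≤ (Real.exp 1 - 1) * lam * ((1 - p) + p * Real.exp lam) :=
    hchord.trans (le_mul_of_one_le_right (hx.trans hchord) hmean)
  have hsq := mul_le_mul_of_nonneg_left (pow_le_pow_left₀ hx hle 2)
    (mul_nonneg hp0 (sub_nonneg.2 hp1))
  rw [hexp]
  linear_combination hsq
end

section
/- Let n ∈ ℕ, p ∈ [0,1], q = 1−p, θ ∈ ℝ, and let 0 < λ ≤ 1 satisfy λ² ≤ 1/(p·q·n) (vacuous if p·q·n = 0). Let S ~ Binomial(n,p) and define g(s) = exp(−λ·(θ·n − s)). Then there is a universal constant C > 0 such that Var[g(S)] ≤ C · (E[g(S)])² · p·q·n·λ². -/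
/-- `E[g(S)]` for `S ~ Binomial(n,p)` and `g(s) = exp(−lam·(θ·n − s))`. -/
noncomputable def expG (n : ℕ) (p θ lam : ℝ) : ℝ :=
  ∑ k ∈ Finset.range (n + 1), binomPMF n p k * Real.exp (-(lam * (θ * n - k)))

/-- `E[g(S)²]` for `S ~ Binomial(n,p)` and `g(s) = exp(−lam·(θ·n − s))`. -/
noncomputable def expG2 (n : ℕ) (p θ lam : ℝ) : ℝ :=
  ∑ k ∈ Finset.range (n + 1), binomPMF n p k * Real.exp (-(lam * (θ * n - k))) ^ 2

/-- The probability generating function of the binomial distribution. -/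
theorem sum_binomPMF_mul_pow (n : ℕ) (p x : ℝ) :
    ∑ k ∈ Finset.range (n + 1), binomPMF n p k * x ^ k = (1 - p + p * x) ^ n := by
  rw [add_comm (1 - p), add_pow]
  refine Finset.sum_congr rfl fun k _ => ?_
  rw [binomPMF, mul_pow]
  ring

theorem expG_eq (n : ℕ) (p θ lam : ℝ) :
    expG n p θ lam = Real.exp (-(lam * (θ * n))) * (1 - p + p * Real.exp lam) ^ n := by
  rw [expG, ← sum_binomPMF_mul_pow, Finset.mul_sum]
  refine Finset.sum_congr rfl fun k _ => ?_
  rw [← Real.exp_nat_mul, mul_left_comm, ← Real.exp_add]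
  congr 2
  ring

theorem expG2_eq_expG (n : ℕ) (p θ lam : ℝ) : expG2 n p θ lam = expG n p θ (2 * lam) := by
  refine Finset.sum_congr rfl fun k _ => ?_
  rw [← Real.exp_nat_mul]
  congr 2
  push_cast
  ring

theorem expG2_eq (n : ℕ) (p θ lam : ℝ) :
    expG2 n p θ lam =
      Real.exp (-(lam * (θ * n))) ^ 2 * (1 - p + p * Real.exp lam ^ 2) ^ n := by
  rw [expG2_eq_expG, expG_eq, ← Real.exp_nat_mul, ← Real.exp_nat_mul]
  congr 2
  push_cast
  ring

/-- One Bernoulli factor: the ratio of the second moment to the squared first moment of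
`exp (lam * X)` is at most `1 + 4 * p * (1 - p) * lam ^ 2`. -/
theorem bernoulli_exp_sq_le {p lam : ℝ} (hp0 : 0 ≤ p) (hp1 : p ≤ 1) (h0 : 0 ≤ lam)
    (h1 : lam ≤ 1) :
    1 - p + p * Real.exp lam ^ 2 ≤
      (1 - p + p * Real.exp lam) ^ 2 * (1 + 4 * (p * (1 - p)) * lam ^ 2) := by
  have hx1 : 1 ≤ Real.exp lam := Real.one_le_exp h0
  have hx2 : Real.exp lam - 1 ≤ 2 * lam := by
    have h := Real.abs_exp_sub_one_le (x := lam) (by rwa [abs_of_nonneg h0])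
    rw [abs_of_nonneg h0] at h
    exact (le_abs_self _).trans h
  have hpq : 0 ≤ p * (1 - p) := mul_nonneg hp0 (sub_nonneg.2 hp1)
  have hM : 1 ≤ (1 - p + p * Real.exp lam) ^ 2 := one_le_pow₀ (by nlinarith)
  have hsq : (Real.exp lam - 1) ^ 2 ≤ (2 * lam) ^ 2 :=
    pow_le_pow_left₀ (sub_nonneg.2 hx1) hx2 2
  calc 1 - p + p * Real.exp lam ^ 2
      = (1 - p + p * Real.exp lam) ^ 2 + p * (1 - p) * (Real.exp lam - 1) ^ 2 := by ring
    _ ≤ (1 - p + p * Real.exp lam) ^ 2 + p * (1 - p) * (2 * lam) ^ 2 := by gcongr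
    _ ≤ (1 - p + p * Real.exp lam) ^ 2
          + (1 - p + p * Real.exp lam) ^ 2 * (p * (1 - p) * (2 * lam) ^ 2) := by
        exact add_le_add_right (le_mul_of_one_le_left (by positivity) hM) _
    _ = _ := by ring

theorem Real.exp_sub_one_le_mul_exp (y : ℝ) : Real.exp y - 1 ≤ y * Real.exp y := by
  have h := mul_le_mul_of_nonneg_right (Real.one_sub_le_exp_neg y) (Real.exp_pos y).le
  rw [← Real.exp_add, neg_add_cancel, Real.exp_zero] at h
  linarith

/-- For `S ~ Binomial(n,p)`, `g(s) = exp(−λ(θn − s))`, `0 < λ ≤ 1`, `λ² ≤ 1/(p(1−p)n)`: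
`Var[g(S)] ≤ C · (E[g(S)])² · p(1−p)n·λ²` for a universal constant `C`. -/
theorem var_exp_binomial :
    ∃ C : ℝ, 0 < C ∧
      ∀ (n : ℕ) (p θ lam : ℝ),
        0 ≤ p → p ≤ 1 →
        0 < lam → lam ≤ 1 →
        lam ^ 2 * (p * (1 - p) * n) ≤ 1 →
        expG2 n p θ lam - expG n p θ lam ^ 2
          ≤ C * expG n p θ lam ^ 2 * (p * (1 - p) * n) * lam ^ 2 := by
  refine ⟨4 * Real.exp 4, by positivity, fun n p θ lam hp0 hp1 h0 h1 hu => ?_⟩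
  have hpq : 0 ≤ p * (1 - p) := mul_nonneg hp0 (sub_nonneg.2 hp1)
  have hq : 0 ≤ 1 - p := sub_nonneg.2 hp1
  set u := lam ^ 2 * (p * (1 - p) * n) with hu_def
  have hu0 : 0 ≤ u := by positivity
  have hpow : (1 + 4 * (p * (1 - p)) * lam ^ 2) ^ n ≤ Real.exp (4 * u) := by
    calc (1 + 4 * (p * (1 - p)) * lam ^ 2) ^ n
        ≤ Real.exp (4 * (p * (1 - p)) * lam ^ 2) ^ n := by
          gcongr
          rw [add_comm]
          exact Real.add_one_le_exp _
      _ = Real.exp (4 * u) := by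
          rw [← Real.exp_nat_mul]
          congr 1
          ring
  have hsecond : expG2 n p θ lam ≤ expG n p θ lam ^ 2 * Real.exp (4 * u) := by
    rw [expG2_eq, expG_eq, mul_pow, mul_assoc]
    gcongr
    calc (1 - p + p * Real.exp lam ^ 2) ^ n
        ≤ ((1 - p + p * Real.exp lam) ^ 2 * (1 + 4 * (p * (1 - p)) * lam ^ 2)) ^ n := by
          gcongr
          exact bernoulli_exp_sq_le hp0 hp1 h0.le h1
      _ = ((1 - p + p * Real.exp lam) ^ n) ^ 2 * (1 + 4 * (p * (1 - p)) * lam ^ 2) ^ n := by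
          rw [mul_pow, pow_right_comm]
      _ ≤ _ := by gcongr
  have hexp : Real.exp (4 * u) - 1 ≤ 4 * u * Real.exp 4 := by
    refine (Real.exp_sub_one_le_mul_exp _).trans ?_
    gcongr
    linarith
  calc expG2 n p θ lam - expG n p θ lam ^ 2
      ≤ expG n p θ lam ^ 2 * (Real.exp (4 * u) - 1) := by linarith
    _ ≤ expG n p θ lam ^ 2 * (4 * u * Real.exp 4) := by gcongr
    _ = _ := by
        rw [hu_def]
        ring
end

section
/- Let A_1, …, A_m ∈ ℂ^{d×d} be quantum events (Hermitian with 0 ≤ A_i ≤ 1), and set #A = A_1 + ⋯ + A_m. Let ν > 0 and let B ∈ ℂ^{d×d} be a Hermitian projector (B² = B) satisfying ν·B ≤ #A and (1−B)·#A·(1−B) ≤ ν·(1−B) (these hold when B is the spectral projector of #A onto eigenvalues ≥ ν). Then for every quantum state ρ ∈ ℂ^{d×d}, writing p_max = max_{1≤i≤m} tr(ρ A_i), one has p_max − 2√ν ≤ tr(ρ B) ≤ tr(ρ · #A)/ν. -/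
open Matrix
open scoped ComplexOrder

/-- The trace of a product of two positive semidefinite matrices has nonnegative real part. -/
theorem Matrix.PosSemidef.re_trace_mul_nonneg {n : Type*} [Fintype n] [DecidableEq n]
    {ρ M : Matrix n n ℂ} (hρ : ρ.PosSemidef) (hM : M.PosSemidef) :
    0 ≤ ((ρ * M).trace).re := by
  open scoped MatrixOrder in
    obtain ⟨C, rfl⟩ := CStarAlgebra.nonneg_iff_eq_star_mul_self.mp hρ.nonneg
  rw [star_eq_conjTranspose, Matrix.mul_assoc, Matrix.trace_mul_comm]
  exact (Complex.le_def.mp (hM.mul_mul_conjTranspose_same C).trace_nonneg).1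

/-- A quantum event `E` whose compression to the range of the complementary projector `1 - B` is at
most `s ^ 2` has probability at most `tr (ρ B) + 2 s`. -/
theorem re_trace_mul_sub_two_mul_le {n : Type*} [Fintype n] [DecidableEq n]
    {E B ρ : Matrix n n ℂ} (hE0 : E.PosSemidef) (hE1 : (1 - E).PosSemidef)
    (hB : B.IsHermitian) (hBproj : B * B = B) {s : ℝ} (hs : 0 < s)
    (hcomp : (((s ^ 2 : ℝ) : ℂ) • (1 - B) - (1 - B) * E * (1 - B)).PosSemidef)
    (hρ : ρ.PosSemidef) (hρ1 : ρ.trace = 1) :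
    ((ρ * E).trace).re - 2 * s ≤ ((ρ * B).trace).re := by
  have hconj {X M : Matrix n n ℂ} (hX : X.IsHermitian) (hM : M.PosSemidef) :
      (X * M * X).PosSemidef := by
    simpa only [hX.eq] using hM.mul_mul_conjTranspose_same X
  have hP : (1 - B).IsHermitian := isHermitian_one.sub hB
  have hS : ((s : ℂ) • (1 : Matrix n n ℂ) - (1 - B)).IsHermitian := by
    refine IsHermitian.sub ?_ hP
    simp [IsHermitian, conjTranspose_smul]
  have hBpsd : B.PosSemidef := by
    simpa [hBproj] using hconj hB PosSemidef.one
  have hBEB := hρ.re_trace_mul_nonneg (hconj hB hE1)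
  have hPEP := hρ.re_trace_mul_nonneg (hconj hP hE0)
  have hSES := hρ.re_trace_mul_nonneg (hconj hS hE0)
  have hE := hρ.re_trace_mul_nonneg hE1
  have hC := hρ.re_trace_mul_nonneg hcomp
  have hB0 := hρ.re_trace_mul_nonneg hBpsd
  simp only [mul_sub, sub_mul, mul_one, one_mul, smul_mul_assoc, mul_smul_comm, smul_sub,
    trace_sub, trace_smul, hBproj, hρ1, Complex.sub_re, smul_eq_mul, Complex.re_ofReal_mul,
    Complex.one_re, Complex.ofReal_re] at hBEB hPEP hSES hE hC
  have key : s * (((ρ * E).trace).re - 2 * s - ((ρ * B).trace).re) ≤ 0 := by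
    nlinarith [mul_nonneg hs.le hBEB, mul_nonneg hs.le hPEP, mul_nonneg (sq_nonneg s) hE,
      mul_nonneg (sq_nonneg s) hB0]
  linarith [nonpos_of_mul_nonpos_right key hs]

/-- **Quantum OR bound (Harrow–Lin–Montanaro style).**  Let `A₁, …, A_m` be quantum events,
`#A = Σ Aᵢ`, `ν > 0`, and let `B` be a Hermitian projector with `ν·B ≤ #A` and
`(1−B)·#A·(1−B) ≤ ν·(1−B)`.  Then for every quantum state `ρ`:
`p_max − 2√ν ≤ tr(ρB) ≤ tr(ρ·#A)/ν`, where `p_max = maxᵢ tr(ρAᵢ)`. -/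
theorem quantum_or_bound {d m : ℕ} (A : Fin m → Matrix (Fin d) (Fin d) ℂ)
    (hAherm : ∀ i, (A i).IsHermitian)
    (hA0 : ∀ i, (A i).PosSemidef)
    (hA1 : ∀ i, ((1 : Matrix (Fin d) (Fin d) ℂ) - A i).PosSemidef)
    (ν : ℝ) (hν : 0 < ν)
    (B : Matrix (Fin d) (Fin d) ℂ) (hB : B.IsHermitian) (hBproj : B * B = B)
    (hlow : ((∑ i, A i) - (ν : ℂ) • B).PosSemidef)
    (hhigh : ((ν : ℂ) • ((1 : Matrix (Fin d) (Fin d) ℂ) - B)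
        - ((1 - B) * (∑ i, A i) * (1 - B))).PosSemidef)
    (ρ : Matrix (Fin d) (Fin d) ℂ) (hρ : ρ.PosSemidef) (hρ1 : ρ.trace = 1) :
    (∀ i, ((ρ * A i).trace).re - 2 * Real.sqrt ν ≤ ((ρ * B).trace).re)
    ∧ ((ρ * B).trace).re ≤ ((ρ * ∑ i, A i).trace).re / ν := by
  refine ⟨fun i => ?_, ?_⟩
  · refine re_trace_mul_sub_two_mul_le (hA0 i) (hA1 i) hB hBproj (Real.sqrt_pos.mpr hν) ?_ hρ hρ1
    have hrest : (∑ j ∈ Finset.univ.erase i, A j).PosSemidef :=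
      posSemidef_sum _ fun j _ => hA0 j
    have hP : (1 - B)ᴴ = 1 - B := (isHermitian_one.sub hB).eq
    have hcomp := hhigh.add (hP ▸ hrest.mul_mul_conjTranspose_same (1 - B))
    rw [Real.sq_sqrt hν.le]
    convert hcomp using 1
    rw [← Finset.add_sum_erase _ A (Finset.mem_univ i), mul_add, add_mul]
    abel
  · have h := hρ.re_trace_mul_nonneg hlow
    rw [mul_sub, trace_sub, mul_smul_comm, trace_smul, Complex.sub_re, smul_eq_mul,
      Complex.re_ofReal_mul] at h
    rw [le_div_iff₀ hν]
    linarith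
end

section
/- Let E ∈ ℂ^{d×d} be a quantum event (Hermitian with 0 ≤ E ≤ 1), and let 0 < ε, δ < 1/2 and τ, c ∈ [0,1]. Then there exist n ∈ ℕ with n ≤ C·log(1/δ)/ε² for a universal constant C (with n depending only on ε and δ, not on E), and a quantum event B on the n-fold tensor power space, 0 ≤ B ≤ 1 with B ∈ ℂ^{d^n × d^n}, such that for every quantum state ρ ∈ ℂ^{d×d}: if |tr(ρE) − τ| > c + ε then tr(ρ^{⊗n} B) ≥ 1 − δ, and if |tr(ρE) − τ| ≤ c − ε then tr(ρ^{⊗n} B) ≤ δ. Moreover, if E is a projector (E² = E), then B can be chosen to be a projector. -/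
open Matrix
open scoped ComplexOrder

/-- The `n`-fold Kronecker (tensor) power of a matrix, with entries
`(ρ^{⊗n}) x y = ∏ i, ρ (x i) (y i)`. -/
noncomputable def tensorPow {d : ℕ} (ρ : Matrix (Fin d) (Fin d) ℂ) (n : ℕ) :
    Matrix (Fin n → Fin d) (Fin n → Fin d) ℂ :=
  fun x y => ∏ i, ρ (x i) (y i)

open scoped MatrixOrder Matrix.Norms.L2Operator in
theorem Matrix.PosSemidef.exists_eq_conjTranspose_mul_self {m : Type*} [Fintype m]
    [DecidableEq m] {A : Matrix m m ℂ} (hA : A.PosSemidef) : ∃ C : Matrix m m ℂ, A = Cᴴ * C :=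
  CStarAlgebra.nonneg_iff_eq_star_mul_self.mp hA.nonneg

/-- The tensor (Kronecker) product of a finite family of matrices. -/
noncomputable def tensorFamily {d n : ℕ} (A : Fin n → Matrix (Fin d) (Fin d) ℂ) :
    Matrix (Fin n → Fin d) (Fin n → Fin d) ℂ :=
  fun x y => ∏ i, A i (x i) (y i)

namespace tensorFamily

variable {d n : ℕ}

theorem mul (A B : Fin n → Matrix (Fin d) (Fin d) ℂ) :
    tensorFamily A * tensorFamily B = tensorFamily fun i => A i * B i := by
  ext x y
  simp only [tensorFamily, Matrix.mul_apply, Fintype.prod_sum, Finset.prod_mul_distrib]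

theorem conjTranspose (A : Fin n → Matrix (Fin d) (Fin d) ℂ) :
    (tensorFamily A)ᴴ = tensorFamily fun i => (A i)ᴴ := by
  ext x y
  simp [tensorFamily, Matrix.conjTranspose_apply]

theorem trace (A : Fin n → Matrix (Fin d) (Fin d) ℂ) :
    (tensorFamily A).trace = ∏ i, (A i).trace := by
  simp only [tensorFamily, Matrix.trace, Matrix.diag, Fintype.prod_sum]

theorem one : tensorFamily (fun _ : Fin n => (1 : Matrix (Fin d) (Fin d) ℂ)) = 1 := by
  ext x y
  simp only [tensorFamily, Matrix.one_apply, funext_iff]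
  simp only [Finset.prod_ite_zero, Finset.mem_univ, true_implies, Finset.prod_const_one]

theorem sum {β : Type*} [Fintype β] (A : Fin n → β → Matrix (Fin d) (Fin d) ℂ) :
    ∑ s : Fin n → β, tensorFamily (fun i => A i (s i)) = tensorFamily fun i => ∑ b, A i b := by
  ext x y
  simp only [tensorFamily, Matrix.sum_apply, Fintype.prod_sum]

theorem eq_zero {A : Fin n → Matrix (Fin d) (Fin d) ℂ} {i : Fin n} (h : A i = 0) :
    tensorFamily A = 0 := by
  ext x y
  exact Finset.prod_eq_zero (Finset.mem_univ i) (by simp [h])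

theorem posSemidef {A : Fin n → Matrix (Fin d) (Fin d) ℂ} (hA : ∀ i, (A i).PosSemidef) :
    (tensorFamily A).PosSemidef := by
  choose C hC using fun i => (hA i).exists_eq_conjTranspose_mul_self
  rw [funext hC, ← mul, ← conjTranspose]
  exact Matrix.posSemidef_conjTranspose_mul_self _

end tensorFamily

theorem Matrix.PosSemidef.trace_mul_nonneg {m : Type*} [Fintype m] [DecidableEq m]
    {A B : Matrix m m ℂ} (hA : A.PosSemidef) (hB : B.PosSemidef) : 0 ≤ (A * B).trace := by
  obtain ⟨C, rfl⟩ := hA.exists_eq_conjTranspose_mul_self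
  rw [Matrix.mul_assoc, Matrix.trace_mul_comm]
  exact (hB.mul_mul_conjTranspose_same C).trace_nonneg

/-- The two-outcome measurement `{E, 1 - E}`. -/
noncomputable def binaryMeasurement {d : ℕ} (E : Matrix (Fin d) (Fin d) ℂ) (b : Bool) :
    Matrix (Fin d) (Fin d) ℂ :=
  if b then E else 1 - E

theorem binaryMeasurement_posSemidef {d : ℕ} {E : Matrix (Fin d) (Fin d) ℂ}
    (hE : E.PosSemidef) (hE' : (1 - E).PosSemidef) (b : Bool) :
    (binaryMeasurement E b).PosSemidef := by
  cases b <;> simpa [binaryMeasurement]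

/-- The event that the outcome string of `n` independent measurements `{E, 1 - E}`
belongs to `S`. -/
noncomputable def outcomeEvent {d n : ℕ} (E : Matrix (Fin d) (Fin d) ℂ)
    (S : Finset (Fin n → Bool)) : Matrix (Fin n → Fin d) (Fin n → Fin d) ℂ :=
  ∑ s ∈ S, tensorFamily fun i => binaryMeasurement E (s i)

section outcomeEvent

variable {d n : ℕ} {E : Matrix (Fin d) (Fin d) ℂ}

theorem outcomeEvent_posSemidef (hE : E.PosSemidef) (hE' : (1 - E).PosSemidef)
    (S : Finset (Fin n → Bool)) : (outcomeEvent E S).PosSemidef :=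
  Matrix.posSemidef_sum _ fun _ _ =>
    tensorFamily.posSemidef fun _ => binaryMeasurement_posSemidef hE hE' _

theorem one_sub_outcomeEvent (S : Finset (Fin n → Bool)) :
    1 - outcomeEvent E S = outcomeEvent E Sᶜ := by
  have h : ∑ s : Fin n → Bool, tensorFamily (fun i => binaryMeasurement E (s i)) = 1 := by
    rw [tensorFamily.sum (fun _ => binaryMeasurement E)]
    simp [binaryMeasurement, tensorFamily.one]
  rw [sub_eq_iff_eq_add, ← h, outcomeEvent, outcomeEvent, Finset.sum_compl_add_sum]

theorem outcomeEvent_mul_self (hE : E * E = E) (S : Finset (Fin n → Bool)) :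
    outcomeEvent E S * outcomeEvent E S = outcomeEvent E S := by
  have hb (a b : Bool) : binaryMeasurement E a * binaryMeasurement E b
      = if a = b then binaryMeasurement E a else 0 := by
    cases a <;> cases b <;> simp [binaryMeasurement, mul_sub, sub_mul, hE]
  simp only [outcomeEvent, Finset.sum_mul_sum, tensorFamily.mul, hb]
  refine Finset.sum_congr rfl fun s hs => ?_
  rw [Finset.sum_eq_single_of_mem s hs]
  · simp
  · intro t _ hts
    obtain ⟨i, hi⟩ := Function.ne_iff.mp hts
    exact tensorFamily.eq_zero (i := i) (if_neg fun h => hi h.symm)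

/-- The probability of a single outcome of a coin of bias `p`. -/
def coinWeight (p : ℝ) (b : Bool) : ℝ := if b then p else 1 - p

theorem trace_tensorPow_mul_outcomeEvent {ρ : Matrix (Fin d) (Fin d) ℂ} {p : ℝ}
    (hρ : ρ.trace = 1) (hp : (ρ * E).trace = p) (S : Finset (Fin n → Bool)) :
    (tensorPow ρ n * outcomeEvent E S).trace.re = ∑ s ∈ S, ∏ i, coinWeight p (s i) := by
  have hb (b : Bool) : (ρ * binaryMeasurement E b).trace = (coinWeight p b : ℂ) := by
    cases b <;> simp [binaryMeasurement, coinWeight, mul_sub, hρ, hp]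
  change (tensorFamily (fun _ => ρ) * _).trace.re = _
  simp only [outcomeEvent, Finset.mul_sum, tensorFamily.mul, Matrix.trace_sum,
    tensorFamily.trace, hb]
  norm_cast

end outcomeEvent

theorem coinWeight_nonneg {p : ℝ} (h0 : 0 ≤ p) (h1 : p ≤ 1) (b : Bool) : 0 ≤ coinWeight p b := by
  cases b <;> simpa [coinWeight]

theorem sum_prod_coinWeight (n : ℕ) (p : ℝ) :
    ∑ s : Fin n → Bool, ∏ i, coinWeight p (s i) = 1 := by
  rw [← Fintype.prod_sum fun _ : Fin n => coinWeight p]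
  simp [coinWeight]

/-- The number of successes in a string of outcomes. -/
def successes {n : ℕ} (s : Fin n → Bool) : ℝ := ∑ i, if s i then 1 else 0

theorem centered_mgf_le {p t : ℝ} (h0 : 0 ≤ p) (h1 : p ≤ 1) (ht : |t| ≤ 1) :
    p * Real.exp (t * (1 - p)) + (1 - p) * Real.exp (t * (0 - p)) ≤ Real.exp (t ^ 2) := by
  have bound {u : ℝ} (hu : |u| ≤ 1) : Real.exp (t * u) ≤ 1 + t * u + t ^ 2 := by
    have h : |t * u| ≤ 1 := by
      rw [abs_mul]
      exact mul_le_one₀ ht (abs_nonneg _) hu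
    have h2 := (abs_le.mp (Real.abs_exp_sub_one_sub_id_le h)).2
    have h3 : u ^ 2 ≤ 1 := (sq_le_one_iff_abs_le_one u).mpr hu
    nlinarith [mul_le_mul_of_nonneg_left h3 (sq_nonneg t)]
  have ha := bound (u := 1 - p) (abs_le.mpr ⟨by linarith, by linarith⟩)
  have hb := bound (u := 0 - p) (abs_le.mpr ⟨by linarith, by linarith⟩)
  have hc := Real.add_one_le_exp (t ^ 2)
  nlinarith [mul_le_mul_of_nonneg_left ha h0, mul_le_mul_of_nonneg_left hb (sub_nonneg.mpr h1)]

theorem sum_prod_coinWeight_mul_exp_le (n : ℕ) {p t : ℝ} (h0 : 0 ≤ p) (h1 : p ≤ 1)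
    (ht : |t| ≤ 1) :
    ∑ s : Fin n → Bool, (∏ i, coinWeight p (s i)) * Real.exp (t * (successes s - n * p))
      ≤ Real.exp (n * t ^ 2) := by
  have h (s : Fin n → Bool) :
      (∏ i, coinWeight p (s i)) * Real.exp (t * (successes s - n * p))
        = ∏ i, coinWeight p (s i) * Real.exp (t * ((if s i then 1 else 0) - p)) := by
    rw [Finset.prod_mul_distrib, ← Real.exp_sum, ← Finset.mul_sum, Finset.sum_sub_distrib]
    simp [successes]
  simp only [h]
  rw [← Fintype.prod_sum fun (_ : Fin n) (b : Bool) =>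
    coinWeight p b * Real.exp (t * ((if b then 1 else 0) - p))]
  simp only [Fintype.sum_bool, Finset.prod_const, Finset.card_univ, Fintype.card_fin]
  rw [Real.exp_nat_mul]
  refine pow_le_pow_left₀ ?_ ?_ n
  · exact add_nonneg (mul_nonneg (coinWeight_nonneg h0 h1 _) (Real.exp_nonneg _))
      (mul_nonneg (coinWeight_nonneg h0 h1 _) (Real.exp_nonneg _))
  · simpa [coinWeight] using centered_mgf_le h0 h1 ht

/-- A two-sided Chernoff bound for sums of independent coin flips. -/
theorem sum_prod_coinWeight_le_of_deviation {n : ℕ} {p ε : ℝ} (h0 : 0 ≤ p) (h1 : p ≤ 1)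
    (hε : 0 < ε) (hε1 : ε ≤ 1) (S : Finset (Fin n → Bool))
    (hS : ∀ s ∈ S, n * ε ≤ |successes s - n * p|) :
    ∑ s ∈ S, ∏ i, coinWeight p (s i) ≤ 2 * Real.exp (-(n * ε ^ 2 / 4)) := by
  have hw (s : Fin n → Bool) : 0 ≤ ∏ i, coinWeight p (s i) :=
    Finset.prod_nonneg fun i _ => coinWeight_nonneg h0 h1 _
  set g : (Fin n → Bool) → ℝ := fun s =>
    (Real.exp (ε / 2 * (successes s - n * p)) + Real.exp (-(ε / 2) * (successes s - n * p)))
      * Real.exp (-(n * ε ^ 2 / 2)) with hg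
  have hg0 (s) : 0 ≤ g s := by positivity
  have hg1 (s) (hs : s ∈ S) : 1 ≤ g s := by
    simp only [hg, add_mul, ← Real.exp_add]
    rcases le_abs.mp (hS s hs) with h | h
    · refine le_add_of_le_of_nonneg (Real.one_le_exp ?_) (Real.exp_nonneg _)
      nlinarith
    · refine le_add_of_nonneg_of_le (Real.exp_nonneg _) (Real.one_le_exp ?_)
      nlinarith
  have ht : |ε / 2| ≤ 1 := by rw [abs_of_pos (by positivity)]; linarith
  have hA := sum_prod_coinWeight_mul_exp_le n h0 h1 ht
  have hB := sum_prod_coinWeight_mul_exp_le n h0 h1 (t := -(ε / 2)) (by rwa [abs_neg])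
  rw [neg_sq] at hB
  calc ∑ s ∈ S, ∏ i, coinWeight p (s i)
      ≤ ∑ s ∈ S, (∏ i, coinWeight p (s i)) * g s :=
        Finset.sum_le_sum fun s hs => le_mul_of_one_le_right (hw s) (hg1 s hs)
    _ ≤ ∑ s, (∏ i, coinWeight p (s i)) * g s :=
        Finset.sum_le_univ_sum_of_nonneg fun s => mul_nonneg (hw s) (hg0 s)
    _ = (∑ s, (∏ i, coinWeight p (s i)) * Real.exp (ε / 2 * (successes s - n * p))
          + ∑ s, (∏ i, coinWeight p (s i)) * Real.exp (-(ε / 2) * (successes s - n * p)))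
          * Real.exp (-(n * ε ^ 2 / 2)) := by
        rw [← Finset.sum_add_distrib, Finset.sum_mul]
        exact Finset.sum_congr rfl fun s _ => by simp only [hg]; ring
    _ ≤ (2 * Real.exp (n * (ε / 2) ^ 2)) * Real.exp (-(n * ε ^ 2 / 2)) := by
        gcongr
        linarith
    _ = 2 * Real.exp (-(n * ε ^ 2 / 4)) := by
        rw [mul_assoc, ← Real.exp_add]
        ring_nf

theorem exists_sampleSize {ε δ : ℝ} (hε : 0 < ε) (hε2 : ε < 1 / 2) (hδ : 0 < δ)
    (hδ2 : δ < 1 / 2) :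
    ∃ n : ℕ, 0 < n ∧ (n : ℝ) ≤ 9 * Real.log (1 / δ) / ε ^ 2 ∧
      2 * Real.exp (-(n * ε ^ 2 / 4)) ≤ δ := by
  have hlog : Real.log 2 ≤ Real.log (1 / δ) :=
    Real.log_le_log two_pos (by rw [le_div_iff₀ hδ]; linarith)
  have hl2 := Real.log_two_gt_d9
  have hε' : 0 < ε ^ 2 := by positivity
  have hpos : 0 < 8 * Real.log (1 / δ) / ε ^ 2 := div_pos (by linarith) hε'
  refine ⟨⌈8 * Real.log (1 / δ) / ε ^ 2⌉₊, Nat.ceil_pos.mpr hpos, ?_, ?_⟩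
  · refine (Nat.ceil_lt_add_one hpos.le).le.trans ?_
    rw [div_add_one hε'.ne']
    gcongr
    nlinarith
  · have hn := (div_le_iff₀ hε').mp (Nat.le_ceil (8 * Real.log (1 / δ) / ε ^ 2))
    rw [one_div, Real.log_inv] at hn hlog
    calc 2 * Real.exp _ ≤ 2 * Real.exp (Real.log δ - Real.log 2) := by
          rw [one_div, Real.log_inv]
          gcongr
          linarith
      _ = δ := by rw [Real.exp_sub, Real.exp_log hδ, Real.exp_log two_pos]; ring

/-- **Naive expectation estimation.**  There is a universal constant `C` such that for all
`0 < ε, δ < 1/2` there is `n ≤ C·log(1/δ)/ε²` (depending only on `ε, δ`) so that for every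
quantum event `E` and thresholds `τ, c ∈ [0,1]` there is a quantum event `B` on the `n`-fold
tensor power space with: `|tr(ρE) − τ| > c + ε ⟹ tr(ρ^{⊗n}B) ≥ 1 − δ` and
`|tr(ρE) − τ| ≤ c − ε ⟹ tr(ρ^{⊗n}B) ≤ δ`, for every state `ρ`; moreover `B` is a
projector whenever `E` is. -/
theorem naive_estimation :
    ∃ C : ℝ, 0 < C ∧
      ∀ ε δ : ℝ, 0 < ε → ε < 1 / 2 → 0 < δ → δ < 1 / 2 →
        ∃ n : ℕ, (n : ℝ) ≤ C * Real.log (1 / δ) / ε ^ 2 ∧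
          ∀ (d : ℕ) (τ c : ℝ), 0 ≤ τ → τ ≤ 1 → 0 ≤ c → c ≤ 1 →
            ∀ E : Matrix (Fin d) (Fin d) ℂ,
              E.PosSemidef → ((1 : Matrix (Fin d) (Fin d) ℂ) - E).PosSemidef →
              ∃ B : Matrix (Fin n → Fin d) (Fin n → Fin d) ℂ,
                B.PosSemidef
                ∧ ((1 : Matrix (Fin n → Fin d) (Fin n → Fin d) ℂ) - B).PosSemidef
                ∧ (∀ ρ : Matrix (Fin d) (Fin d) ℂ, ρ.PosSemidef → ρ.trace = 1 →
                    (c + ε < |((ρ * E).trace).re - τ|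
                        → 1 - δ ≤ ((tensorPow ρ n * B).trace).re)
                    ∧ (|((ρ * E).trace).re - τ| ≤ c - ε
                        → ((tensorPow ρ n * B).trace).re ≤ δ))
                ∧ (E * E = E → B * B = B) := by
  refine ⟨9, by norm_num, fun ε δ hε hε2 hδ hδ2 => ?_⟩
  obtain ⟨n, hn0, hn, htail⟩ := exists_sampleSize hε hε2 hδ hδ2
  refine ⟨n, hn, fun d τ c _ _ _ _ E hE hE' => ?_⟩
  classical
  have hn' : (0 : ℝ) < n := by exact_mod_cast hn0
  set S : Finset (Fin n → Bool) := {s | c < |successes s / n - τ|} with hS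
  refine ⟨outcomeEvent E S, outcomeEvent_posSemidef hE hE' S, ?_, fun ρ hρ htr => ?_,
    fun h => outcomeEvent_mul_self h S⟩
  · rw [one_sub_outcomeEvent]
    exact outcomeEvent_posSemidef hE hE' _
  obtain ⟨h0, him⟩ := Complex.nonneg_iff.mp (hρ.trace_mul_nonneg hE)
  have h1 := (Complex.nonneg_iff.mp (hρ.trace_mul_nonneg hE')).1
  have hp : (ρ * E).trace = ((ρ * E).trace.re : ℂ) := Complex.ext (by simp) (by simp [← him])
  rw [mul_sub, mul_one, Matrix.trace_sub, htr, Complex.sub_re, Complex.one_re, sub_nonneg] at h1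
  rw [trace_tensorPow_mul_outcomeEvent htr hp]
  set p := (ρ * E).trace.re
  have hdev (s : Fin n → Bool) (h : ε ≤ |successes s / n - p|) :
      n * ε ≤ |successes s - n * p| := by
    rw [show successes s - n * p = n * (successes s / n - p) by field_simp, abs_mul,
      abs_of_pos hn']
    gcongr
  have hchernoff (T : Finset (Fin n → Bool)) (hT : ∀ s ∈ T, ε ≤ |successes s / n - p|) :
      ∑ s ∈ T, ∏ i, coinWeight p (s i) ≤ δ :=
    (sum_prod_coinWeight_le_of_deviation h0 h1 hε (by linarith) T
      fun s hs => hdev s (hT s hs)).trans htail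
  constructor
  · intro h
    have hc := hchernoff Sᶜ fun s hs => by
      simp only [hS, Finset.mem_compl, Finset.mem_filter, Finset.mem_univ, true_and, not_lt] at hs
      have := abs_sub_le p (successes s / n) τ
      rw [abs_sub_comm p (successes s / n)] at this
      linarith
    have := Finset.sum_add_sum_compl S fun s => ∏ i, coinWeight p (s i)
    rw [sum_prod_coinWeight] at this
    linarith
  · intro h
    refine hchernoff S fun s hs => ?_
    simp only [hS, Finset.mem_filter, Finset.mem_univ, true_and] at hs
    have := abs_sub_le (successes s / n) p τ
    linarith
end
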